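/- Let P be a polymatroid on [n] and let w ∈ S_n be the adjacent transposition swapping h and h+1. Then 𝒯_P(x,y) = 𝒯_{w(P)}(x,y), where 𝒯_P(x,y) = Σ_{a∈P} x^{oi(a)} y^{oe(a)} (x+y−1)^{ie(a)}. -/

import Mathlib

open Finset

/-- The `i`-th standard basis vector in `ℤ^n`. -/
def e {n : ℕ} (i : Fin n) : Fin n → ℤ := fun t => if t = i then 1 else 0

/-- Membership characterization of the polymatroid `P_f`. -/
def IsPolymatroid {n : ℕ} (P : Set (Fin n → ℤ)) (f : Finset (Fin n) → ℤ) : Prop :=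
  (f ∅ = 0) ∧ (∀ I J : Finset (Fin n), f (I ∪ J) + f (I ∩ J) ≤ f I + f J) ∧
    (∀ a : Fin n → ℤ, a ∈ P ↔
      (∀ I : Finset (Fin n), ∑ t ∈ I, a t ≤ f I) ∧ ∑ t, a t = f univ)

/-- `i` is internally active w.r.t. the basis `a` of `P` for the order `lt`. -/
def IntActO {n : ℕ} (P : Set (Fin n → ℤ)) (lt : Fin n → Fin n → Prop)
    (a : Fin n → ℤ) (i : Fin n) : Prop :=
  ∀ j : Fin n, lt j i → a - e i + e j ∉ P

/-- `i` is externally active w.r.t. the basis `a` of `P` for the order `lt`. -/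
def ExtActO {n : ℕ} (P : Set (Fin n → ℤ)) (lt : Fin n → Fin n → Prop)
    (a : Fin n → ℤ) (i : Fin n) : Prop :=
  ∀ j : Fin n, lt j i → a + e i - e j ∉ P

/-- Internal activity for the natural order on `Fin n`. -/
def IntAct {n : ℕ} (P : Set (Fin n → ℤ)) (a : Fin n → ℤ) (i : Fin n) : Prop :=
  IntActO P (· < ·) a i

/-- External activity for the natural order on `Fin n`. -/
def ExtAct {n : ℕ} (P : Set (Fin n → ℤ)) (a : Fin n → ℤ) (i : Fin n) : Prop :=
  ExtActO P (· < ·) a i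

noncomputable def oi {n : ℕ} (P : Set (Fin n → ℤ)) (a : Fin n → ℤ) : ℕ :=
  {i : Fin n | IntAct P a i ∧ ¬ ExtAct P a i}.ncard

noncomputable def oe {n : ℕ} (P : Set (Fin n → ℤ)) (a : Fin n → ℤ) : ℕ :=
  {i : Fin n | ExtAct P a i ∧ ¬ IntAct P a i}.ncard

noncomputable def ie {n : ℕ} (P : Set (Fin n → ℤ)) (a : Fin n → ℤ) : ℕ :=
  {i : Fin n | IntAct P a i ∧ ExtAct P a i}.ncard

/-- The polymatroid Tutte polynomial evaluated at `(x, y)`. -/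
noncomputable def TP {n : ℕ} (P : Set (Fin n → ℤ)) {R : Type*} [CommRing R]
    (x y : R) : R :=
  ∑ᶠ a ∈ P, x ^ oi P a * y ^ oe P a * (x + y - 1) ^ ie P a


def Tight {n : ℕ} (f : Finset (Fin n) → ℤ) (a : Fin n → ℤ) (I : Finset (Fin n)) : Prop :=
  ∑ t ∈ I, a t = f I

lemma sum_e {n : ℕ} (i : Fin n) (I : Finset (Fin n)) :
    ∑ t ∈ I, e i t = if i ∈ I then 1 else 0 := by
  simp [e]

lemma sum_move {n : ℕ} (a : Fin n → ℤ) (i j : Fin n) (I : Finset (Fin n)) :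
    ∑ t ∈ I, (a - e i + e j) t =
      ∑ t ∈ I, a t - (if i ∈ I then 1 else 0) + (if j ∈ I then 1 else 0) := by
  simp only [Pi.add_apply, Pi.sub_apply, sum_add_distrib, sum_sub_distrib, sum_e]

lemma tight_both {n : ℕ} {P : Set (Fin n → ℤ)} {f : Finset (Fin n) → ℤ}
    (hP : IsPolymatroid P f) {a : Fin n → ℤ} (ha : a ∈ P) {I J : Finset (Fin n)}
    (hI : Tight f a I) (hJ : Tight f a J) : Tight f a (I ∪ J) ∧ Tight f a (I ∩ J) := by
  unfold Tight at *
  have h1 := ((hP.2.2 a).1 ha).1 (I ∪ J)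
  have h2 := ((hP.2.2 a).1 ha).1 (I ∩ J)
  have h3 := hP.2.1 I J
  have h4 := Finset.sum_union_inter (s₁ := I) (s₂ := J) (f := a)
  constructor <;> linarith

lemma not_mem_iff {n : ℕ} {P : Set (Fin n → ℤ)} {f : Finset (Fin n) → ℤ}
    (hP : IsPolymatroid P f) {a : Fin n → ℤ} (ha : a ∈ P) (i j : Fin n) :
    a - e i + e j ∉ P ↔ ∃ I, Tight f a I ∧ j ∈ I ∧ i ∉ I := by
  have ha' := (hP.2.2 a).1 ha
  constructor
  · intro hn
    by_contra hc
    apply hn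
    rw [hP.2.2]
    constructor
    · intro I
      rw [sum_move]
      have h1 := ha'.1 I
      by_cases hj : j ∈ I
      · by_cases hi : i ∈ I
        · simp [hi, hj]; exact h1
        · have : ¬ Tight f a I := fun ht => hc ⟨I, ht, hj, hi⟩
          have h2 := lt_of_le_of_ne h1 this
          simp [hi, hj]; omega
      · by_cases hi : i ∈ I <;> simp [hi, hj] <;> omega
    · rw [sum_move]; simp [ha'.2]
  · rintro ⟨I, hI, hj, hi⟩ hm
    have h1 := ((hP.2.2 _).1 hm).1 I
    rw [sum_move] at h1
    simp only [hi, hj, if_true, if_false] at h1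
    unfold Tight at hI
    omega

open Classical in
lemma int_iff {n : ℕ} {P : Set (Fin n → ℤ)} {f : Finset (Fin n) → ℤ}
    (hP : IsPolymatroid P f) {a : Fin n → ℤ} (ha : a ∈ P) (S : Fin n → Prop) (i : Fin n) :
    (∀ j, S j → a - e i + e j ∉ P) ↔ ∃ I, Tight f a I ∧ (∀ j, S j → j ∈ I) ∧ i ∉ I := by
  constructor
  · intro H
    refine ⟨(univ.filter fun I => Tight f a I ∧ i ∉ I).sup id, ?_⟩
    have key : Tight f a ((univ.filter fun I => Tight f a I ∧ i ∉ I).sup id) ∧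
        i ∉ ((univ.filter fun I => Tight f a I ∧ i ∉ I).sup id) := by
      apply Finset.sup_induction (p := fun I => Tight f a I ∧ i ∉ I)
      · simp [Tight, hP.1]
      · intro I hI J hJ
        refine ⟨(tight_both hP ha hI.1 hJ.1).1, ?_⟩
        simp [hI.2, hJ.2]
      · intro I hI
        simpa using hI
    refine ⟨key.1, fun j hj => ?_, key.2⟩
    obtain ⟨I, h1, h2, h3⟩ := (not_mem_iff hP ha i j).1 (H j hj)
    have : I ≤ (univ.filter fun I => Tight f a I ∧ i ∉ I).sup id :=
      Finset.le_sup (f := id) (by simp [h1, h3])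
    exact this h2
  · rintro ⟨I, h1, h2, h3⟩ j hj
    exact (not_mem_iff hP ha i j).2 ⟨I, h1, h2 j hj, h3⟩

open Classical in
lemma ext_iff' {n : ℕ} {P : Set (Fin n → ℤ)} {f : Finset (Fin n) → ℤ}
    (hP : IsPolymatroid P f) {a : Fin n → ℤ} (ha : a ∈ P) (S : Fin n → Prop) (i : Fin n) :
    (∀ j, S j → a + e i - e j ∉ P) ↔ ∃ I, Tight f a I ∧ (∀ j, S j → j ∉ I) ∧ i ∈ I := by
  have hs : ∀ j, a + e i - e j = a - e j + e i := fun j => by abel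
  simp only [hs]
  constructor
  · intro H
    refine ⟨(univ.filter fun I => Tight f a I ∧ i ∈ I).inf id, ?_⟩
    have key : Tight f a ((univ.filter fun I => Tight f a I ∧ i ∈ I).inf id) ∧
        i ∈ ((univ.filter fun I => Tight f a I ∧ i ∈ I).inf id) := by
      apply Finset.inf_induction (p := fun I => Tight f a I ∧ i ∈ I)
      · exact ⟨((hP.2.2 a).1 ha).2, mem_univ _⟩
      · intro I hI J hJ
        refine ⟨(tight_both hP ha hI.1 hJ.1).2, ?_⟩
        simp [hI.2, hJ.2]
      · intro I hI
        simpa using hI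
    refine ⟨key.1, fun j hj hc => ?_, key.2⟩
    obtain ⟨I, h1, h2, h3⟩ := (not_mem_iff hP ha j i).1 (H j hj)
    have : (univ.filter fun I => Tight f a I ∧ i ∈ I).inf id ≤ I :=
      Finset.inf_le (f := id) (by simp [h1, h2])
    exact h3 (this hc)
  · rintro ⟨I, h1, h2, h3⟩ j hj
    exact (not_mem_iff hP ha j i).2 ⟨I, h1, h3, h2 j hj⟩

open Classical in
noncomputable def wt {R : Type*} [CommRing R] (x y : R) (A B : Prop) : R :=
  (if A ∧ ¬ B then x else 1) * (if B ∧ ¬ A then y else 1) * (if A ∧ B then x + y - 1 else 1)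

lemma term_eq {n : ℕ} (P : Set (Fin n → ℤ)) {R : Type*} [CommRing R] (x y : R)
    (a : Fin n → ℤ) : x ^ oi P a * y ^ oe P a * (x + y - 1) ^ ie P a =
      ∏ i, wt x y (IntAct P a i) (ExtAct P a i) := by
  classical
  have key : ∀ (z : R) (p : Fin n → Prop),
      z ^ ({i | p i} : Set (Fin n)).ncard = ∏ i, if p i then z else 1 := by
    intro z p
    rw [Finset.prod_ite]
    simp [Set.ncard_eq_toFinset_card']
  unfold oi oe ie wt
  rw [key, key, key, Finset.prod_mul_distrib, Finset.prod_mul_distrib]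
  congr!

lemma poly_finite {n : ℕ} {P : Set (Fin n → ℤ)} {f : Finset (Fin n) → ℤ}
    (hP : IsPolymatroid P f) : P.Finite := by
  apply (Set.finite_Icc (fun i => f univ - f (univ.erase i)) (fun i => f {i})).subset
  intro a ha
  have h1 := (hP.2.2 a).1 ha
  constructor
  · intro i
    have h2 := h1.1 (univ.erase i)
    have h3 := Finset.add_sum_erase univ a (mem_univ i)
    simp only
    linarith [h1.2]
  · intro i
    simpa using h1.1 {i}

lemma wt_identity {R : Type*} [CommRing R] (x y : R) (a a' b b' p q : Prop)
    (h1 : p → b → b') (h2 : p → a' → a) (h3 : q → b' → b) (h4 : q → a → a') 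
    [Decidable (a ∧ a')] [Decidable (b ∧ b')] [Decidable p] [Decidable q] :
    wt x y a b * wt x y (a' ∧ ¬ p) (b' ∧ ¬ q) - wt x y a' b' * wt x y (a ∧ ¬ q) (b ∧ ¬ p) =
    ((if a ∧ a' then x - x ^ 2 else 0) + (if b ∧ b' then y ^ 2 - y else 0)) *
      ((if p then 1 else 0) - (if q then 1 else 0)) := by
  unfold wt
  by_cases p <;> by_cases q <;> by_cases a <;> by_cases a' <;> by_cases b <;> by_cases b' <;>
    simp_all <;> ring

/-- transfer of activity along the line -/
lemma transfer {n : ℕ} {P : Set (Fin n → ℤ)} {f : Finset (Fin n) → ℤ}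
    (hP : IsPolymatroid P f) (h h' : Fin n) (hh' : (h' : ℕ) = (h : ℕ) + 1)
    {a b : Fin n → ℤ} (ha : a ∈ P) (hb : b ∈ P)
    (hab : ∀ I : Finset (Fin n), (h ∈ I ↔ h' ∈ I) → Tight f a I → Tight f b I)
    (K : Finset (Fin n)) (hK : Tight f a K)
    (hK' : ((∀ j < h, j ∈ K) ∧ h ∉ K ∧ h' ∉ K) ∨ ((∀ j < h, j ∉ K) ∧ h ∈ K ∧ h' ∈ K))
    (i : Fin n) (hi : i ≠ h) (hi' : i ≠ h') :
    (IntAct P a i → IntAct P b i) ∧ (ExtAct P a i → ExtAct P b i) := by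
  have hcase : i < h ∨ (h < i ∧ h' < i) := by
    simp only [Fin.lt_def, ne_eq, Fin.ext_iff] at *
    omega
  unfold IntAct ExtAct IntActO ExtActO
  rw [int_iff hP ha (fun j => j < i), int_iff hP hb (fun j => j < i),
    ext_iff' hP ha (fun j => j < i), ext_iff' hP hb (fun j => j < i)]
  constructor
  · rintro ⟨J, hJ, hJ1, hJ2⟩
    rcases hcase with hc | ⟨hc, hc'⟩
    · rcases hK' with ⟨k1, k2, k3⟩ | ⟨k1, k2, k3⟩
      · refine ⟨J ∩ K, hab _ (by simp [k2, k3]) (tight_both hP ha hJ hK).2, ?_, by simp [hJ2]⟩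
        intro j hj
        exact mem_inter.2 ⟨hJ1 j hj, k1 j (hj.trans hc)⟩
      · refine ⟨J ∪ K, hab _ (by simp [k2, k3]) (tight_both hP ha hJ hK).1, ?_,
          by simp [hJ2, k1 i hc]⟩
        intro j hj
        exact mem_union_left _ (hJ1 j hj)
    · exact ⟨J, hab _ (by simp [hJ1 h hc, hJ1 h' hc']) hJ, hJ1, hJ2⟩
  · rintro ⟨J, hJ, hJ1, hJ2⟩
    rcases hcase with hc | ⟨hc, hc'⟩
    · rcases hK' with ⟨k1, k2, k3⟩ | ⟨k1, k2, k3⟩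
      · refine ⟨J ∩ K, hab _ (by simp [k2, k3]) (tight_both hP ha hJ hK).2, ?_,
          by simp [hJ2, k1 i hc]⟩
        intro j hj
        simp [hJ1 j hj]
      · refine ⟨J ∪ K, hab _ (by simp [k2, k3]) (tight_both hP ha hJ hK).1, ?_, by simp [hJ2]⟩
        intro j hj
        simp [hJ1 j hj, k1 j (hj.trans hc)]
    · exact ⟨J, hab _ (by simp [hJ1 h hc, hJ1 h' hc']) hJ, hJ1, hJ2⟩

def IL {n : ℕ} (P : Set (Fin n → ℤ)) (h : Fin n) (a : Fin n → ℤ) (i : Fin n) : Prop :=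
  ∀ j, j < h → a - e i + e j ∉ P

def EL {n : ℕ} (P : Set (Fin n → ℤ)) (h : Fin n) (a : Fin n → ℤ) (i : Fin n) : Prop :=
  ∀ j, j < h → a + e i - e j ∉ P

lemma alpha_iff {n : ℕ} {P : Set (Fin n → ℤ)} {f : Finset (Fin n) → ℤ}
    (hP : IsPolymatroid P f) (h h' : Fin n) {a : Fin n → ℤ} (ha : a ∈ P) :
    (IL P h a h ∧ IL P h a h') ↔
      ∃ K, Tight f a K ∧ (∀ j < h, j ∈ K) ∧ h ∉ K ∧ h' ∉ K := by
  unfold IL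
  rw [int_iff hP ha (fun j => j < h), int_iff hP ha (fun j => j < h)]
  constructor
  · rintro ⟨⟨I, i1, i2, i3⟩, ⟨J, j1, j2, j3⟩⟩
    exact ⟨I ∩ J, (tight_both hP ha i1 j1).2, fun j hj => mem_inter.2 ⟨i2 j hj, j2 j hj⟩,
      by simp [i3], by simp [j3]⟩
  · rintro ⟨K, k1, k2, k3, k4⟩
    exact ⟨⟨K, k1, k2, k3⟩, ⟨K, k1, k2, k4⟩⟩

lemma beta_iff {n : ℕ} {P : Set (Fin n → ℤ)} {f : Finset (Fin n) → ℤ}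
    (hP : IsPolymatroid P f) (h h' : Fin n) {a : Fin n → ℤ} (ha : a ∈ P) :
    (EL P h a h ∧ EL P h a h') ↔
      ∃ K, Tight f a K ∧ (∀ j < h, j ∉ K) ∧ h ∈ K ∧ h' ∈ K := by
  unfold EL
  rw [ext_iff' hP ha (fun j => j < h), ext_iff' hP ha (fun j => j < h)]
  constructor
  · rintro ⟨⟨I, i1, i2, i3⟩, ⟨J, j1, j2, j3⟩⟩
    exact ⟨I ∪ J, (tight_both hP ha i1 j1).1, fun j hj => by simp [i2 j hj, j2 j hj],
      by simp [i3], by simp [j3]⟩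
  · rintro ⟨K, k1, k2, k3, k4⟩
    exact ⟨⟨K, k1, k2, k3⟩, ⟨K, k1, k2, k4⟩⟩

noncomputable def WW {n : ℕ} (P : Set (Fin n → ℤ)) {R : Type*} [CommRing R] (x y : R)
    (h h' : Fin n) (a : Fin n → ℤ) : R :=
  ∏ i ∈ (univ.erase h).erase h', wt x y (IntAct P a i) (ExtAct P a i)

open Classical in
noncomputable def GG {n : ℕ} (P : Set (Fin n → ℤ)) {R : Type*} [CommRing R] (x y : R)
    (h h' : Fin n) (a : Fin n → ℤ) : R :=
  WW P x y h h' a * ((if IL P h a h ∧ IL P h a h' then x - x ^ 2 else 0) +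
    (if EL P h a h ∧ EL P h a h' then y ^ 2 - y else 0))

lemma GG_const {n : ℕ} {P : Set (Fin n → ℤ)} {f : Finset (Fin n) → ℤ}
    (hP : IsPolymatroid P f) (h h' : Fin n) (hh' : (h' : ℕ) = (h : ℕ) + 1)
    {R : Type*} [CommRing R] (x y : R)
    {a b : Fin n → ℤ} (ha : a ∈ P) (hb : b ∈ P)
    (hab : ∀ I : Finset (Fin n), (h ∈ I ↔ h' ∈ I) → (Tight f a I ↔ Tight f b I)) :
    GG P x y h h' a = GG P x y h h' b := by
  classical
  have hα : (IL P h a h ∧ IL P h a h') ↔ (IL P h b h ∧ IL P h b h') := by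
    rw [alpha_iff hP h h' ha, alpha_iff hP h h' hb]
    refine exists_congr fun K => ?_
    constructor
    · rintro ⟨k1, k2, k3, k4⟩
      exact ⟨(hab K (by simp [k3, k4])).1 k1, k2, k3, k4⟩
    · rintro ⟨k1, k2, k3, k4⟩
      exact ⟨(hab K (by simp [k3, k4])).2 k1, k2, k3, k4⟩
  have hβ : (EL P h a h ∧ EL P h a h') ↔ (EL P h b h ∧ EL P h b h') := by
    rw [beta_iff hP h h' ha, beta_iff hP h h' hb]
    refine exists_congr fun K => ?_
    constructor
    · rintro ⟨k1, k2, k3, k4⟩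
      exact ⟨(hab K (by simp [k3, k4])).1 k1, k2, k3, k4⟩
    · rintro ⟨k1, k2, k3, k4⟩
      exact ⟨(hab K (by simp [k3, k4])).2 k1, k2, k3, k4⟩
  have hW : (∃ K, Tight f a K ∧ (((∀ j < h, j ∈ K) ∧ h ∉ K ∧ h' ∉ K) ∨
      ((∀ j < h, j ∉ K) ∧ h ∈ K ∧ h' ∈ K))) → WW P x y h h' a = WW P x y h h' b := by
    rintro ⟨K, k1, k2⟩
    have k1' : Tight f b K := (hab K (by tauto)).1 k1
    unfold WW
    refine Finset.prod_congr rfl fun i hi => ?_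
    simp only [mem_erase, mem_univ, and_true] at hi
    have t1 := transfer hP h h' hh' ha hb (fun I hI => (hab I hI).1) K k1 k2 i hi.2 hi.1
    have t2 := transfer hP h h' hh' hb ha (fun I hI => (hab I hI).2) K k1' k2 i hi.2 hi.1
    rw [propext ⟨t1.1, t2.1⟩, propext ⟨t1.2, t2.2⟩]
  unfold GG
  by_cases h1 : IL P h a h ∧ IL P h a h'
  · rw [hW]
    · simp only [hα, hβ]
    · obtain ⟨K, k⟩ := (alpha_iff hP h h' ha).1 h1
      exact ⟨K, k.1, Or.inl k.2⟩
  · by_cases h2 : EL P h a h ∧ EL P h a h'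
    · rw [hW]
      · simp only [hα, hβ]
      · obtain ⟨K, k⟩ := (beta_iff hP h h' ha).1 h2
        exact ⟨K, k.1, Or.inr k.2⟩
    · have h1' := fun hc => h1 (hα.2 hc)
      have h2' := fun hc => h2 (hβ.2 hc)
      rw [if_neg h1, if_neg h2, if_neg h1', if_neg h2']
      simp

lemma pointwise {n : ℕ} {P : Set (Fin n → ℤ)} {f : Finset (Fin n) → ℤ}
    (hP : IsPolymatroid P f) (h h' : Fin n) (hh' : (h' : ℕ) = (h : ℕ) + 1)
    {R : Type*} [CommRing R] (x y : R) {a : Fin n → ℤ} (ha : a ∈ P)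
    [Decidable (a - e h' + e h ∈ P)] [Decidable (a - e h + e h' ∈ P)] :
    ∏ i, wt x y (IntAct P a i) (ExtAct P a i) -
    ∏ i, wt x y (IntActO P (fun j k => Equiv.swap h h' j < Equiv.swap h h' k) a i)
      (ExtActO P (fun j k => Equiv.swap h h' j < Equiv.swap h h' k) a i) =
    GG P x y h h' a * ((if a - e h' + e h ∈ P then 1 else 0) -
      (if a - e h + e h' ∈ P then 1 else 0)) := by
  classical
  have hne : h' ≠ h := by
    intro hc; rw [hc] at hh'; omega
  have split : ∀ g : Fin n → R,
      ∏ i, g i = g h * (g h' * ∏ i ∈ (univ.erase h).erase h', g i) := by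
    intro g
    rw [Finset.mul_prod_erase _ _ (by simp [hne]), Finset.mul_prod_erase _ _ (by simp)]
  have hs : ∀ i j, a + e i - e j = a - e j + e i := fun i j => by abel
  -- order comparisons
  have o0 : ∀ j i : Fin n, i ≠ h → i ≠ h' →
      (Equiv.swap h h' j < Equiv.swap h h' i ↔ j < i) := by
    intro j i hi hi'
    rw [Equiv.swap_apply_of_ne_of_ne hi hi', Equiv.swap_apply_def]
    simp only [Fin.lt_def, ne_eq, Fin.ext_iff] at *
    split_ifs <;> omega
  have o1 : ∀ j : Fin n, j < h' ↔ (j < h ∨ j = h) := by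
    intro j
    simp only [Fin.lt_def, Fin.ext_iff] at *
    omega
  have o2 : ∀ j : Fin n, (Equiv.swap h h' j < Equiv.swap h h' h') ↔ j < h := by
    intro j
    rw [Equiv.swap_apply_right, Equiv.swap_apply_def]
    simp only [Fin.lt_def, ne_eq, Fin.ext_iff] at *
    split_ifs <;> omega
  have o3 : ∀ j : Fin n, (Equiv.swap h h' j < Equiv.swap h h' h) ↔ (j < h ∨ j = h') := by
    intro j
    rw [Equiv.swap_apply_left, Equiv.swap_apply_def]
    simp only [Fin.lt_def, ne_eq, Fin.ext_iff] at *
    split_ifs <;> omega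
  have i1 : IntAct P a h = IL P h a h := rfl
  have i2 : ExtAct P a h = EL P h a h := rfl
  have i3 : IntAct P a h' = (IL P h a h' ∧ ¬ (a - e h' + e h ∈ P)) := by
    simp only [IntAct, IntActO, IL, o1, or_imp, forall_and, forall_eq]
  have i4 : ExtAct P a h' = (EL P h a h' ∧ ¬ (a - e h + e h' ∈ P)) := by
    simp only [ExtAct, ExtActO, EL, o1, or_imp, forall_and, forall_eq, hs]
  have i5 : IntActO P (fun j k => Equiv.swap h h' j < Equiv.swap h h' k) a h' = IL P h a h' := by
    simp only [IntActO, IL, o2]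
  have i6 : ExtActO P (fun j k => Equiv.swap h h' j < Equiv.swap h h' k) a h' = EL P h a h' := by
    simp only [ExtActO, EL, o2]
  have i7 : IntActO P (fun j k => Equiv.swap h h' j < Equiv.swap h h' k) a h =
      (IL P h a h ∧ ¬ (a - e h + e h' ∈ P)) := by
    simp only [IntActO, IL, o3, or_imp, forall_and, forall_eq]
  have i8 : ExtActO P (fun j k => Equiv.swap h h' j < Equiv.swap h h' k) a h =
      (EL P h a h ∧ ¬ (a - e h' + e h ∈ P)) := by
    simp only [ExtActO, EL, o3, or_imp, forall_and, forall_eq, hs]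
  have hW : ∏ i ∈ (univ.erase h).erase h',
      wt x y (IntActO P (fun j k => Equiv.swap h h' j < Equiv.swap h h' k) a i)
      (ExtActO P (fun j k => Equiv.swap h h' j < Equiv.swap h h' k) a i) = WW P x y h h' a := by
    unfold WW
    refine Finset.prod_congr rfl fun i hi => ?_
    simp only [mem_erase, mem_univ, and_true] at hi
    have := fun j => o0 j i hi.2 hi.1
    simp only [IntAct, ExtAct, IntActO, ExtActO, this]
  -- implications
  have np := not_mem_iff hP ha h' h
  have nq := not_mem_iff hP ha h h'
  have IH := int_iff hP ha (fun j => j < h) h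
  have IH' := int_iff hP ha (fun j => j < h) h'
  have EH := ext_iff' hP ha (fun j => j < h) h
  have EH' := ext_iff' hP ha (fun j => j < h) h'
  have c1 : a - e h' + e h ∈ P → EL P h a h → EL P h a h' := by
    intro hp hE
    obtain ⟨I, t1, t2, t3⟩ := EH.1 hE
    refine EH'.2 ⟨I, t1, t2, ?_⟩
    by_contra hc
    exact np.2 ⟨I, t1, t3, hc⟩ hp
  have c2 : a - e h' + e h ∈ P → IL P h a h' → IL P h a h := by
    intro hp hE
    obtain ⟨I, t1, t2, t3⟩ := IH'.1 hE
    refine IH.2 ⟨I, t1, t2, ?_⟩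
    intro hc
    exact np.2 ⟨I, t1, hc, t3⟩ hp
  have c3 : a - e h + e h' ∈ P → EL P h a h' → EL P h a h := by
    intro hp hE
    obtain ⟨I, t1, t2, t3⟩ := EH'.1 hE
    refine EH.2 ⟨I, t1, t2, ?_⟩
    by_contra hc
    exact nq.2 ⟨I, t1, t3, hc⟩ hp
  have c4 : a - e h + e h' ∈ P → IL P h a h → IL P h a h' := by
    intro hp hE
    obtain ⟨I, t1, t2, t3⟩ := IH.1 hE
    refine IH'.2 ⟨I, t1, t2, ?_⟩
    intro hc
    exact nq.2 ⟨I, t1, hc, t3⟩ hp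
  have main := wt_identity x y _ _ _ _ _ _ c1 c2 c3 c4
  rw [split, split (fun i => wt x y (IntActO P _ a i) _), hW, i1, i2, i3, i4, i5, i6, i7, i8]
  change _ * (_ * WW P x y h h' a) - _ = _
  unfold GG
  rw [mul_assoc (WW P x y h h' a), ← main]
  ring

lemma mem_image_iff {n : ℕ} (P : Set (Fin n → ℤ)) (σ : Equiv.Perm (Fin n)) (hσ : ∀ i, σ (σ i) = i)
    (b : Fin n → ℤ) : b ∈ (fun b : Fin n → ℤ => b ∘ σ) '' P ↔ b ∘ σ ∈ P := by
  constructor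
  · rintro ⟨a, ha, rfl⟩
    have : (a ∘ σ) ∘ σ = a := by ext i; simp [hσ]
    simpa [this] using ha
  · intro hb
    exact ⟨b ∘ σ, hb, by ext i; simp [hσ]⟩

lemma e_swap {n : ℕ} (σ : Equiv.Perm (Fin n)) (hσ : ∀ i, σ (σ i) = i) (i t : Fin n) :
    e i (σ t) = e (σ i) t := by
  unfold e
  have : σ t = i ↔ t = σ i := by
    constructor
    · rintro rfl; rw [hσ]
    · rintro rfl; rw [hσ]
  simp [this]

theorem stmt14 {n : ℕ} (P : Set (Fin n → ℤ)) (f : Finset (Fin n) → ℤ)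
    (hP : IsPolymatroid P f) (h h' : Fin n) (hh' : (h' : ℕ) = (h : ℕ) + 1)
    (Q : Set (Fin n → ℤ)) (hQ : Q = (fun b => b ∘ Equiv.swap h h') '' P)
    (R : Type*) [CommRing R] (x y : R) :
    TP P x y = TP Q x y := by
  classical
  have hne : h' ≠ h := by
    intro hc; rw [hc] at hh'; omega
  have hσ : ∀ i, Equiv.swap h h' (Equiv.swap h h' i) = i := fun i => Equiv.swap_apply_self h h' i
  have hfin := poly_finite hP
  have hTQ : TP Q x y = ∑ᶠ a ∈ P, ∏ i,
      wt x y (IntActO P (fun j k => Equiv.swap h h' j < Equiv.swap h h' k) a i)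
      (ExtActO P (fun j k => Equiv.swap h h' j < Equiv.swap h h' k) a i) := by
    unfold TP
    simp only [term_eq]
    have hinj : Set.InjOn (fun b : Fin n → ℤ => b ∘ Equiv.swap h h') P := by
      intro a _ b _ hab
      ext i
      have := congrFun hab (Equiv.swap h h' i)
      simpa [hσ] using this
    conv_lhs => rw [hQ]
    rw [finsum_mem_image hinj]
    refine finsum_mem_congr rfl fun a ha => ?_
    rw [← Equiv.prod_comp (Equiv.swap h h')]
    refine Finset.prod_congr rfl fun k _ => ?_
    congr 1
    · unfold IntAct IntActO
      rw [← hQ, ← (Equiv.swap h h').forall_congr_right]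
      refine propext (forall_congr' fun j => imp_congr_right fun _ => not_congr ?_)
      rw [hQ, mem_image_iff P _ hσ]
      apply Eq.to_iff
      congr 1
      ext t
      simp [e_swap _ hσ, hσ]
    · unfold ExtAct ExtActO
      rw [← hQ, ← (Equiv.swap h h').forall_congr_right]
      refine propext (forall_congr' fun j => imp_congr_right fun _ => not_congr ?_)
      rw [hQ, mem_image_iff P _ hσ]
      apply Eq.to_iff
      congr 1
      ext t
      simp [e_swap _ hσ, hσ]
  rw [hTQ]
  unfold TP
  simp only [term_eq]
  rw [finsum_mem_eq_finite_toFinset_sum _ hfin, finsum_mem_eq_finite_toFinset_sum _ hfin,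
    ← sub_eq_zero, ← Finset.sum_sub_distrib]
  rw [Finset.sum_congr rfl fun a ha =>
    pointwise hP h h' hh' x y (hfin.mem_toFinset.1 ha)]
  simp only [mul_sub, mul_ite, mul_one, mul_zero]
  rw [Finset.sum_sub_distrib, sub_eq_zero, ← Finset.sum_filter, ← Finset.sum_filter]
  refine Finset.sum_bij' (fun a _ => a - e h' + e h) (fun a _ => a - e h + e h') ?_ ?_ ?_ ?_ ?_
  · intro a ha
    simp only [mem_filter, Set.Finite.mem_toFinset] at ha ⊢
    refine ⟨ha.2, ?_⟩
    convert ha.1 using 1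
    abel
  · intro a ha
    simp only [mem_filter, Set.Finite.mem_toFinset] at ha ⊢
    refine ⟨ha.2, ?_⟩
    convert ha.1 using 1
    abel
  · intro a _
    abel
  · intro a _
    abel
  · intro a ha
    simp only [mem_filter, Set.Finite.mem_toFinset] at ha
    refine GG_const hP h h' hh' x y ha.1 ha.2 fun I hI => ?_
    unfold Tight
    rw [sum_move]
    simp only [hI]
    simp
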